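/- For any positive integers u and v there exist indices i ≥ 1 and j ≥ 0 with j + 1 ≤ s_i − 1 such that u = ⟨i,j⟩ and v = ⟨i,j+1⟩; that is, every ordered pair of positive integers occurs as a pair of neighbouring entries in some row of the hyperbolic Pascal triangle {4,5}. -/

import Mathlib

/-- Type of a vertex in a hyperbolic Pascal triangle: winger, A, or B. -/
inductive HVType where
  | W : HVType
  | A : HVType
  | B : HVType
deriving DecidableEq, Repr

/-- Number of type-B children produced by a vertex of the given type
in the hyperbolic Pascal triangle `{4,q}`. -/
def hBCount (q : ℕ) : HVType → ℕ
  | .A => q - 4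
  | .B => q - 3
  | .W => 0

/-- The inner part of the next row: for each pair of consecutive vertices a shared
type-A child whose value is the sum of the parents' values, followed by the
type-B copies of the right parent. -/
def hMid (q : ℕ) : List (HVType × ℕ) → List (HVType × ℕ)
  | a :: b :: rest =>
      (HVType.A, a.2 + b.2) ::
        (List.replicate (hBCount q b.1) (HVType.B, b.2) ++ hMid q (b :: rest))
  | _ => []

/-- Row `n` of the hyperbolic Pascal triangle `{4,q}`, as a list of
(type, value) pairs read from left to right. -/
def hRow (q : ℕ) : ℕ → List (HVType × ℕ)
  | 0 => [(HVType.W, 1)]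
  | n + 1 => (HVType.W, 1) :: (hMid q (hRow q n) ++ [(HVType.W, 1)])

/-- Number of type-A vertices of row `n`. -/
def hCountA (q n : ℕ) : ℕ := ((hRow q n).filter (fun v => v.1 = HVType.A)).length

/-- Number of type-B vertices of row `n`. -/
def hCountB (q n : ℕ) : ℕ := ((hRow q n).filter (fun v => v.1 = HVType.B)).length

/-- Sum of the values of the type-A vertices of row `n`. -/
def hSumA (q n : ℕ) : ℕ :=
  (((hRow q n).filter (fun v => v.1 = HVType.A)).map Prod.snd).sum

/-- Sum of the values of the type-B vertices of row `n`. -/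
def hSumB (q n : ℕ) : ℕ :=
  (((hRow q n).filter (fun v => v.1 = HVType.B)).map Prod.snd).sum

/-- The number `s_n` of vertices of row `n`. -/
def hLen (q n : ℕ) : ℕ := (hRow q n).length

/-- The value of the `k`-th (0-indexed) vertex of row `n`. -/
def hVal (q n k : ℕ) : ℕ := ((hRow q n).getD k (HVType.W, 0)).2

/-- The type of the `k`-th (0-indexed) vertex of row `n`. -/
def hType (q n k : ℕ) : HVType := ((hRow q n).getD k (HVType.W, 0)).1

/-- `u` and `v` are the values of two consecutive vertices of some row `i ≥ 1` of `{4,5}`. -/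
def HAdj (u v : ℕ) : Prop :=
  ∃ i p a b s, 1 ≤ i ∧ hRow 5 i = p ++ a :: b :: s ∧ a.2 = u ∧ b.2 = v

theorem hMid_append (q : ℕ) (p s : List (HVType × ℕ)) (a b : HVType × ℕ) :
    hMid q (p ++ a :: b :: s) = hMid q (p ++ [a]) ++
      (HVType.A, a.2 + b.2) :: (List.replicate (hBCount q b.1) (HVType.B, b.2) ++
        hMid q (b :: s)) := by
  induction p with
  | nil => simp [hMid]
  | cons c p ih =>
    cases p with
    | nil => simp [hMid]
    | cons d p =>
      simp only [List.cons_append] at ih ⊢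
      simp [hMid, ih]

theorem ne_W_of_mem_hMid (q : ℕ) (l : List (HVType × ℕ)) :
    ∀ x ∈ hMid q l, x.1 ≠ HVType.W := by
  induction l with
  | nil => simp [hMid]
  | cons a l ih =>
    cases l with
    | nil => simp [hMid]
    | cons b l =>
      intro x hx
      simp only [hMid, List.mem_cons, List.mem_append, List.mem_replicate] at hx
      rcases hx with rfl | ⟨-, rfl⟩ | hx
      · simp
      · simp
      · exact ih x hx

theorem hRow_left {q i : ℕ} (hi : 1 ≤ i) {p s : List (HVType × ℕ)} {a b : HVType × ℕ}
    (h : hRow q i = p ++ a :: b :: s) :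
    (p = [] ∧ a = (HVType.W, 1)) ∨ (p ≠ [] ∧ a.1 ≠ HVType.W) := by
  obtain ⟨n, rfl⟩ := Nat.exists_eq_add_of_le' hi
  cases p with
  | nil =>
    simp only [hRow, List.nil_append, List.cons.injEq] at h
    exact Or.inl ⟨rfl, h.1.symm⟩
  | cons c p =>
    refine Or.inr ⟨by simp, ne_W_of_mem_hMid q (hRow q n) a ?_⟩
    simp only [hRow, List.cons_append, List.cons.injEq] at h
    have h' := congrArg List.dropLast h.2
    rw [List.dropLast_concat, List.dropLast_append_of_ne_nil (by simp)] at h'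
    simp [h']

theorem hRow_right {q i : ℕ} (hi : 1 ≤ i) {p s : List (HVType × ℕ)} {a b : HVType × ℕ}
    (h : hRow q i = p ++ a :: b :: s) :
    (s = [] ∧ b = (HVType.W, 1)) ∨ (s ≠ [] ∧ b.1 ≠ HVType.W) := by
  obtain ⟨n, rfl⟩ := Nat.exists_eq_add_of_le' hi
  rcases List.eq_nil_or_concat' s with rfl | ⟨s, c, rfl⟩
  · left
    have h' := congrArg List.getLast? h
    simp [hRow, List.getLast?_append, List.getLast?_cons] at h'
    exact ⟨rfl, h'.symm⟩
  · refine Or.inr ⟨by simp, ne_W_of_mem_hMid q (hRow q n) b ?_⟩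
    have h' := congrArg (fun l => l.dropLast.tail) h
    have e : p ++ a :: b :: (s ++ [c]) = (p ++ a :: b :: s) ++ [c] := by simp
    have e' : hRow q (n + 1) = ((HVType.W, 1) :: hMid q (hRow q n)) ++ [(HVType.W, 1)] := by
      simp [hRow]
    simp only [e, e', List.dropLast_concat, List.tail_cons] at h'
    rw [h']
    cases p <;> simp

theorem hBCount_five_pos {t : HVType} (ht : t ≠ HVType.W) : ∃ k, hBCount 5 t = k + 1 := by
  cases t
  · exact absurd rfl ht
  · exact ⟨0, rfl⟩
  · exact ⟨1, rfl⟩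

/-- The shared child of two consecutive vertices, together with its two neighbours. -/
theorem hRow_succ_children {i : ℕ} (hi : 1 ≤ i) {p s : List (HVType × ℕ)} {a b : HVType × ℕ}
    (h : hRow 5 i = p ++ a :: b :: s) :
    ∃ p' x y s', hRow 5 (i + 1) = p' ++ x :: (HVType.A, a.2 + b.2) :: y :: s' ∧
      x.2 = a.2 ∧ y.2 = b.2 ∧ (b.1 ≠ HVType.W → y.1 = HVType.B) := by
  have hl : ∃ p' x, (HVType.W, 1) :: hMid 5 (p ++ [a]) = p' ++ [x] ∧ x.2 = a.2 := by
    rcases hRow_left hi h with ⟨rfl, rfl⟩ | ⟨hp, ha⟩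
    · exact ⟨[], (HVType.W, 1), by simp [hMid], rfl⟩
    · obtain ⟨p, c, rfl⟩ := (List.eq_nil_or_concat' p).resolve_left hp
      obtain ⟨k, hk⟩ := hBCount_five_pos ha
      refine ⟨(HVType.W, 1) :: (hMid 5 (p ++ [c]) ++
        (HVType.A, c.2 + a.2) :: List.replicate k (HVType.B, a.2)), (HVType.B, a.2), ?_, rfl⟩
      have e : p ++ [c] ++ [a] = p ++ c :: a :: [] := by simp
      rw [e, hMid_append, hk, List.replicate_succ']
      simp [hMid]
  have hr : ∃ y s', List.replicate (hBCount 5 b.1) (HVType.B, b.2) ++ hMid 5 (b :: s) ++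
      [(HVType.W, 1)] = y :: s' ∧ y.2 = b.2 ∧ (b.1 ≠ HVType.W → y.1 = HVType.B) := by
    rcases hRow_right hi h with ⟨rfl, rfl⟩ | ⟨-, hb⟩
    · exact ⟨(HVType.W, 1), [], by simp [hMid, hBCount], rfl, by simp⟩
    · obtain ⟨k, hk⟩ := hBCount_five_pos hb
      exact ⟨(HVType.B, b.2), _, by rw [hk, List.replicate_succ]; rfl, rfl, fun _ => rfl⟩
  obtain ⟨p', x, hpx, hx⟩ := hl
  obtain ⟨y, s', hys, hy, hyB⟩ := hr
  refine ⟨p', x, y, s', ?_, hx, hy, hyB⟩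
  rw [hRow, h, hMid_append, ← hys]
  have e : ∀ t, p' ++ x :: t = (p' ++ [x]) ++ t := by simp
  rw [e, ← hpx]
  simp

theorem HAdj.add_right {u v : ℕ} (h : HAdj u v) : HAdj u (u + v) := by
  obtain ⟨i, p, a, b, s, hi, h, rfl, rfl⟩ := h
  obtain ⟨p', x, y, s', h', hx, -, -⟩ := hRow_succ_children hi h
  exact ⟨i + 1, p', x, _, _, by omega, h', hx, rfl⟩

theorem HAdj.add_left {u v : ℕ} (h : HAdj u v) : HAdj (u + v) v := by
  obtain ⟨i, p, a, b, s, hi, h, rfl, rfl⟩ := h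
  obtain ⟨p', x, y, s', hc, -, hy, -⟩ := hRow_succ_children hi h
  exact ⟨i + 1, p' ++ [x], _, y, s', by omega, by simpa using hc, rfl, hy⟩

/-- The sum of two neighbours is the value of two consecutive type-B vertices further down. -/
theorem HAdj.add_self {u v : ℕ} (h : HAdj u v) : HAdj (u + v) (u + v) := by
  obtain ⟨i, p, a, b, s, hi, h, rfl, rfl⟩ := h
  obtain ⟨p₁, x₁, y₁, s₁, h₁, -, -, -⟩ := hRow_succ_children hi h
  obtain ⟨p₂, x₂, ⟨t, w⟩, s₂, h₂, -, hw, ht⟩ := hRow_succ_children (by omega) h₁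
  obtain rfl : w = a.2 + b.2 := hw
  obtain rfl : t = HVType.B := ht (by simp)
  generalize (HVType.A, x₁.2 + (HVType.A, a.2 + b.2).2) = c at h₂
  rw [List.append_cons] at h₂
  refine ⟨i + 3, (HVType.W, 1) :: (hMid 5 (p₂ ++ [x₂] ++ [c]) ++ [(HVType.A, c.2 + (a.2 + b.2))]),
    (HVType.B, a.2 + b.2), (HVType.B, a.2 + b.2),
    hMid 5 ((HVType.B, a.2 + b.2) :: s₂) ++ [(HVType.W, 1)], by omega, ?_, rfl, rfl⟩
  rw [hRow, h₂, hMid_append]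
  simp [hBCount, List.replicate_succ]

theorem hAdj_of_pos (n : ℕ) : ∀ u v : ℕ, u + v = n → 0 < u → 0 < v → HAdj u v := by
  induction n using Nat.strong_induction_on with
  | _ n ih =>
    intro u v hn hu hv
    rcases lt_trichotomy u v with h | rfl | h
    · have := (ih v (by omega) u (v - u) (by omega) hu (by omega)).add_right
      rwa [Nat.add_sub_cancel' h.le] at this
    · rcases (show u = 1 ∨ 2 ≤ u by omega) with rfl | h
      · exact ⟨1, [], (HVType.W, 1), (HVType.W, 1), [], le_rfl, rfl, rfl, rfl⟩
      · have := (ih u (by omega) 1 (u - 1) (by omega) one_pos (by omega)).add_self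
        rwa [Nat.add_sub_cancel' hu] at this
    · have := (ih u (by omega) (u - v) v (by omega) (by omega) hv).add_left
      rwa [Nat.sub_add_cancel h.le] at this

/-- every ordered pair of positive integers occurs as a pair of
neighbouring entries in some row of the hyperbolic Pascal triangle `{4,5}`. -/
theorem stmt_17 (u v : ℕ) (hu : 0 < u) (hv : 0 < v) :
    ∃ i j : ℕ, 1 ≤ i ∧ j + 1 ≤ hLen 5 i - 1 ∧
      hVal 5 i j = u ∧ hVal 5 i (j + 1) = v := by
  obtain ⟨i, p, a, b, s, hi, h, rfl, rfl⟩ := hAdj_of_pos _ u v rfl hu hv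
  refine ⟨i, p.length, hi, ?_, ?_, ?_⟩
  · simp [hLen, h]
  · simp [hVal, h]
  · simp [hVal, h]
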